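/- Let d ≥ 1 be an integer and let k be a field of characteristic 0. Suppose there exists an element of kˣ that is a d-th power in k(μ_d) but not a d-th power in k (i.e. H¹(k(μ_d)/k, μ_d) ≠ 0). Then at least one of the following holds: (a) there exist distinct primes p and q dividing d, with pⁿ the exact power of p dividing d, such that some element of kˣ is a pⁿ-th power in k(μ_q) but not a pⁿ-th power in k; or (b) there exists n ≥ 2 such that 2ⁿ is the exact power of 2 dividing d and (k, 2ⁿ) is the special case. -/

import Mathlib

/-- The field `k(μ_m)` obtained by adjoining all `m`-th roots of unity, realised inside an
algebraic closure of `k`. -/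
noncomputable def cycloExt (k : Type*) [Field k] (m : ℕ) :
    IntermediateField k (AlgebraicClosure k) :=
  IntermediateField.adjoin k {x : AlgebraicClosure k | x ^ m = 1}

/-- `(k, pⁿ)` is the *special case*: `p = 2`, `n ≥ 2`, and there is a `k`-automorphism of
`k(μ_{2ⁿ})` inverting all `2ⁿ`-th roots of unity (equivalently, `k ∩ ℚ(μ_{2ⁿ})` is totally
real). -/
def IsSpecialCase (k : Type*) [Field k] (p n : ℕ) : Prop :=
  p = 2 ∧ 2 ≤ n ∧
    ∃ σ : cycloExt k (2 ^ n) ≃ₐ[k] cycloExt k (2 ^ n),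
      ∀ ζ : cycloExt k (2 ^ n), ζ ^ 2 ^ n = 1 → σ ζ = ζ⁻¹

theorem aux_not_dvd (p : ℕ) (hp : p.Prime) (n : ℕ) (b : ℤ) (hb : (p : ℤ) ∣ b - 1)
    (h1 : ¬ (p : ℤ) ^ n ∣ b - 1) (h2 : p = 2 → 2 ≤ n → ¬ (p : ℤ) ^ n ∣ b + 1) :
    ¬ (p : ℤ) ^ (n + 1) ∣ b ^ p - 1 := by
  have hpZ : Prime (p : ℤ) := Nat.prime_iff_prime_int.mp hp
  rcases hp.eq_two_or_odd' with rfl | hodd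
  · intro h
    have hn : 2 ≤ n := by
      by_contra hn
      apply h1
      interval_cases n
      · simp
      · simpa using hb
    replace h2 := h2 rfl hn
    push_cast at h h1 h2 hb
    rw [show b ^ 2 - 1 = (b - 1) * (b + 1) by ring] at h
    obtain ⟨c, hc⟩ := hb
    have hb' : b = 2 * c + 1 := by linarith
    subst hb'
    obtain ⟨r, rfl⟩ : ∃ r, n = r + 1 := ⟨n - 1, by omega⟩
    have h1' : ¬ (2 : ℤ) ^ r ∣ c := by
      rintro ⟨e, rfl⟩; exact h1 ⟨e, by ring⟩
    have h2' : ¬ (2 : ℤ) ^ r ∣ c + 1 := by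
      rintro ⟨e, he⟩
      exact h2 ⟨e, by rw [show 2 * c + 1 + 1 = 2 * (c + 1) by ring, he]; ring⟩
    have h3 : (2 : ℤ) ^ r ∣ c * (c + 1) := by
      obtain ⟨e, he⟩ := h
      refine ⟨e, ?_⟩
      have : (4 : ℤ) * (c * (c + 1)) = 4 * (2 ^ r * e) := by
        rw [pow_succ, pow_succ] at he; linarith
      linarith
    rcases Int.even_or_odd c with hc | hc
    · have : IsCoprime ((2 : ℤ) ^ r) (c + 1) := by
        apply IsCoprime.pow_left
        exact Int.isCoprime_two_left.mpr hc.add_one 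
      exact h1' (this.dvd_of_dvd_mul_right h3)
    · have : IsCoprime ((2 : ℤ) ^ r) c := by
        apply IsCoprime.pow_left
        exact Int.isCoprime_two_left.mpr hc
      exact h2' (this.dvd_of_dvd_mul_left h3)
  · intro h
    have hb' : ¬ (p : ℤ) ∣ b := by
      intro hh
      have : (p : ℤ) ∣ 1 := by simpa using dvd_sub hh hb
      exact hpZ.not_dvd_one this
    have := Int.emultiplicity_pow_sub_pow hp hodd hb hb' p
    rw [one_pow] at this
    have h4 := le_emultiplicity_of_pow_dvd h
    rw [this] at h4
    have h5 : emultiplicity p p = 1 := by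
      have := emultiplicity_pow_self (p := p) hp.ne_zero hp.prime.not_isUnit 1
      simpa using this
    have h6 := emultiplicity_lt_iff_not_dvd.mpr h1
    rw [h5] at h4
    push_cast at h4
    have h7 : (n : ℕ∞) ≤ emultiplicity (p:ℤ) (b-1) := (ENat.add_le_add_iff_right (by simp)).mp h4
    exact absurd h7 (not_le.mpr h6)

theorem nt_key (p : ℕ) (hp : p.Prime) (n : ℕ) (a : ℤ) (ha : (p : ℤ) ∣ a - 1)
    (h2 : p = 2 → 2 ≤ n → ∀ j : ℕ, ¬ (p : ℤ) ^ n ∣ a ^ j + 1) :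
    ∃ m : ℕ, (p : ℤ) ^ n ∣ a ^ m - 1 ∧
      ∀ u : ℤ, (p : ℤ) ^ n ∣ (∑ i ∈ Finset.range m, a ^ i) * u →
        ∃ w : ℤ, (p : ℤ) ^ n ∣ u - (a - 1) * w := by
  have hpZ : Prime (p : ℤ) := Nat.prime_iff_prime_int.mp hp
  by_cases h1 : (p : ℤ) ^ n ∣ a - 1
  · exact ⟨1, by simpa using h1, fun u hu => ⟨0, by simpa using hu⟩⟩
  have hex : ∃ e : ℕ, (p : ℤ) ^ n ∣ a ^ p ^ e - 1 := by
    refine ⟨n, ?_⟩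
    have := dvd_sub_pow_of_dvd_sub ha n
    rw [one_pow] at this
    exact (pow_dvd_pow _ (Nat.le_succ n)).trans this
  classical
  obtain ⟨e, he⟩ : ∃ e, Nat.find hex = e + 1 := by
    refine Nat.exists_eq_succ_of_ne_zero fun h0 => h1 ?_
    have := Nat.find_spec hex
    rw [h0] at this
    simpa using this
  have hspec := Nat.find_spec hex
  have hmin : ¬ (p : ℤ) ^ n ∣ a ^ p ^ e - 1 := Nat.find_min hex (by omega)
  rw [he] at hspec
  refine ⟨p ^ (e + 1), hspec, fun u hu => ?_⟩
  have hnd : ¬ (p : ℤ) ^ (n + 1) ∣ a ^ p ^ (e + 1) - 1 := by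
    rw [pow_succ p e, pow_mul]
    refine aux_not_dvd p hp n _ (ha.trans (by simpa using sub_dvd_pow_sub_pow a 1 (p ^ e))) hmin ?_
    intro hp2 hn
    exact h2 hp2 hn _
  set S := ∑ i ∈ Finset.range (p ^ (e + 1)), a ^ i with hS
  have hprod : S * (a - 1) = a ^ p ^ (e + 1) - 1 := geom_sum_mul a _
  rw [← hprod] at hnd
  have hS0 : S ≠ 0 := by rintro h; simp [h] at hnd
  have ha0 : a - 1 ≠ 0 := by rintro h; simp [h] at hnd
  obtain ⟨S', hSe, hS'⟩ := (Int.finiteMultiplicity_iff.mpr ⟨by simpa using hp.ne_one, hS0⟩ :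
    FiniteMultiplicity (p : ℤ) S).exists_eq_pow_mul_and_not_dvd
  obtain ⟨a', hae, ha'⟩ := (Int.finiteMultiplicity_iff.mpr ⟨by simpa using hp.ne_one, ha0⟩ :
    FiniteMultiplicity (p : ℤ) (a - 1)).exists_eq_pow_mul_and_not_dvd
  generalize multiplicity (p : ℤ) S = s at hSe
  generalize multiplicity (p : ℤ) (a - 1) = t at hae
  have hst : s + t ≤ n := by
    by_contra hlt
    apply hnd
    rw [hSe, hae]
    refine (pow_dvd_pow (p : ℤ) (show n + 1 ≤ s + t by omega)).trans ⟨S' * a', by ring⟩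
  obtain ⟨r, rfl⟩ : ∃ r, n = s + (t + r) := ⟨n - s - t, by omega⟩
  have hcS : IsCoprime ((p : ℤ) ^ (t + r)) S' :=
    IsCoprime.pow_left ((Prime.coprime_iff_not_dvd hpZ).mpr hS')
  have hca : IsCoprime ((p : ℤ) ^ (s + (t + r))) a' :=
    IsCoprime.pow_left ((Prime.coprime_iff_not_dvd hpZ).mpr ha')
  have hu1 : (p : ℤ) ^ (t + r) ∣ S' * u := by
    rw [hSe, mul_assoc, pow_add] at hu
    exact (mul_dvd_mul_iff_left (pow_ne_zero _ hpZ.ne_zero)).mp hu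
  have hu2 := hcS.dvd_of_dvd_mul_left hu1
  obtain ⟨u', rfl⟩ := (pow_dvd_pow (p : ℤ) (Nat.le_add_right t r)).trans hu2
  obtain ⟨x, c, hxc⟩ := hca
  refine ⟨c * u', ⟨x * (p : ℤ) ^ t * u', ?_⟩⟩
  rw [hae]
  linear_combination (-(p : ℤ) ^ t * u') * hxc

/-- If `p ∤ a - 1` then `a - 1` is invertible modulo `p ^ n`. -/
theorem nt_unit (p : ℕ) (hp : p.Prime) (n : ℕ) (a : ℤ) (ha : ¬ (p : ℤ) ∣ a - 1) (u : ℤ) :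
    ∃ w : ℤ, (p : ℤ) ^ n ∣ u - (a - 1) * w := by
  have hpZ : Prime (p : ℤ) := Nat.prime_iff_prime_int.mp hp
  have hca : IsCoprime ((p : ℤ) ^ n) (a - 1) :=
    IsCoprime.pow_left ((Prime.coprime_iff_not_dvd hpZ).mpr ha)
  obtain ⟨x, c, hxc⟩ := hca
  exact ⟨c * u, ⟨x * u, by linear_combination (-u) * hxc⟩⟩

/-- A subgroup of `(ℤ/2ⁿ)ˣ` not containing `-1` is cyclic. -/
theorem cyclic_two (n : ℕ) (H : Subgroup (ZMod (2 ^ n))ˣ) (h : 2 ≤ n → (-1 : (ZMod (2 ^ n))ˣ) ∉ H) :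
    IsCyclic H := by
  by_cases hn : n ≤ 2
  · have := (ZMod.isCyclic_units_two_pow_iff n).mpr hn
    infer_instance
  obtain ⟨r, rfl⟩ : ∃ r, n = r + 2 := ⟨n - 2, by omega⟩
  replace h := h (by omega)
  have hNZ : NeZero (2 ^ (r + 2)) := ⟨by positivity⟩
  let Z : Subgroup (ZMod (2 ^ (r + 2)))ˣ := Subgroup.zpowers (-1)
  have hmemZ : ∀ x, x ∈ Z → x = 1 ∨ x = -1 := by
    rintro x ⟨i, rfl⟩
    rcases Int.even_or_odd i with hi | hi
    · left; simp [hi.neg_one_zpow]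
    · right; simp [hi.neg_one_zpow]
  have h4 : (4 : ℕ) ∣ 2 ^ (r + 2) := ⟨2 ^ r, by ring⟩
  have hne : (-1 : (ZMod (2 ^ (r + 2)))ˣ) ≠ 1 := by
    intro h
    have h' := congrArg (fun x : (ZMod (2 ^ (r + 2)))ˣ => ZMod.castHom h4 (ZMod 4) (x : ZMod _)) h
    simp only [Units.val_neg, Units.val_one, map_neg, map_one] at h'
    revert h'; decide
  have h5 : IsUnit (5 : ZMod (2 ^ (r + 2))) := by
    have : ((5 : ℕ) : ZMod (2 ^ (r + 2))) = 5 := by norm_cast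
    rw [← this, ZMod.isUnit_iff_coprime]
    exact Nat.Coprime.pow_right _ (by norm_num)
  have ho : orderOf h5.unit = 2 ^ r := by
    rw [← orderOf_injective _ Units.coeHom_injective h5.unit, Units.coeHom_apply, IsUnit.unit_spec]
    exact ZMod.orderOf_five r
  have hpow : ∀ j : ℕ, h5.unit ^ j ∈ Z → h5.unit ^ j = 1 := by
    intro j hj
    rcases hmemZ _ hj with h | h
    · exact h
    · exfalso
      have h' := congrArg (fun x : (ZMod (2 ^ (r + 2)))ˣ =>
        ZMod.castHom h4 (ZMod 4) (x : ZMod _)) h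
      simp only [Units.val_pow_eq_pow_val, IsUnit.unit_spec, map_pow, Units.val_neg, Units.val_one,
        map_neg, map_one, map_ofNat] at h'
      rw [show (5 : ZMod 4) = 1 from rfl, one_pow] at h'
      revert h'; decide
  have hcardZ : Nat.card Z = 2 := by
    rw [Nat.card_zpowers]
    exact orderOf_eq_prime (by simp) hne
  have hcyc : IsCyclic ((ZMod (2 ^ (r + 2)))ˣ ⧸ Z) := by
    apply isCyclic_of_orderOf_eq_card (QuotientGroup.mk h5.unit)
    have hc := Subgroup.card_eq_card_quotient_mul_card_subgroup Z
    rw [hcardZ, Nat.card_eq_fintype_card, ZMod.card_units_eq_totient,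
      Nat.totient_prime_pow_succ Nat.prime_two] at hc
    have : orderOf (QuotientGroup.mk h5.unit : (ZMod (2 ^ (r + 2)))ˣ ⧸ Z) = orderOf h5.unit := by
      apply orderOf_eq_orderOf_iff.mpr
      intro j
      rw [← QuotientGroup.mk_pow, QuotientGroup.eq_one_iff]
      exact ⟨hpow j, fun h => h ▸ Z.one_mem⟩
    rw [this, ho]
    rw [pow_succ] at hc
    omega
  refine isCyclic_of_injective ((QuotientGroup.mk' Z).comp H.subtype) ?_
  rw [injective_iff_map_eq_one]
  rintro ⟨x, hx⟩ hx1
  have : x ∈ Z := by simpa using hx1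
  rcases hmemZ x this with rfl | rfl
  · rfl
  · exact absurd hx h

/-- Every automorphism raises a primitive root of unity to an integral power. -/
theorem exists_zpow {K : Type*} [Field K] {P : ℕ} (hP : P ≠ 0) {ζ : K} (hζ : IsPrimitiveRoot ζ P)
    {w : K} (hw : w ^ P = 1) : ∃ u : ℤ, w = ζ ^ u := by
  have := NeZero.mk hP
  obtain ⟨i, -, hi⟩ := hζ.eq_pow_of_pow_eq_one hw
  exact ⟨i, by rw [zpow_natCast, hi]⟩

theorem descend {k K : Type*} [Field k] [Field K] [Algebra k K] [FiniteDimensional k K]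
    [IsGalois k K] {P : ℕ} {ζ : K} (hζ : IsPrimitiveRoot ζ P) (x : k) (y : K)
    (hy : y ^ P = algebraMap k K x) (w : ℤ) (hfix : ∀ σ : K ≃ₐ[k] K, σ (y * ζ ^ w) = y * ζ ^ w) :
    ∃ z : k, z ^ P = x := by
  obtain ⟨z, hz⟩ := (IsGalois.mem_range_algebraMap_iff_fixed (y * ζ ^ w)).mpr hfix
  refine ⟨z, (algebraMap k K).injective ?_⟩
  rw [map_pow, hz, mul_pow, hy, ← zpow_natCast, ← zpow_mul, mul_comm w, zpow_mul, zpow_natCast,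
    hζ.pow_eq_one, one_zpow, mul_one]

theorem sah {k K : Type*} [Field k] [Field K] [Algebra k K] [FiniteDimensional k K]
    [IsGalois k K] (hcomm : ∀ σ τ : K ≃ₐ[k] K, ∀ z, σ (τ z) = τ (σ z)) {p n : ℕ} (hp : p.Prime)
    {ζ : K} (hζ : IsPrimitiveRoot ζ (p ^ n)) (x : k) (y : K) (hy0 : y ≠ 0)
    (hy : y ^ p ^ n = algebraMap k K x) (g : K ≃ₐ[k] K) (a : ℤ) (hg : g ζ = ζ ^ a)
    (ha : ¬ (p : ℤ) ∣ a - 1) :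
    ∃ z : k, z ^ p ^ n = x := by
  have hP : p ^ n ≠ 0 := pow_ne_zero _ hp.ne_zero
  have hζ0 : ζ ≠ 0 := hζ.ne_zero hP
  have hc : ∀ σ : K ≃ₐ[k] K, ∃ u : ℤ, σ y = y * ζ ^ u := by
    intro σ
    have : (σ y / y) ^ p ^ n = 1 := by
      rw [div_pow, ← map_pow, hy, σ.commutes, ← hy, div_self (pow_ne_zero _ hy0)]
    obtain ⟨u, hu⟩ := exists_zpow hP hζ this
    exact ⟨u, by rw [← hu]; field_simp⟩
  have hz : ∀ σ : K ≃ₐ[k] K, ∃ u : ℤ, σ ζ = ζ ^ u := by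
    intro σ
    exact exists_zpow hP hζ (by rw [← map_pow, hζ.pow_eq_one, map_one])
  obtain ⟨u, hu⟩ := hc g
  obtain ⟨w, hw⟩ := nt_unit p hp n a ha u
  have hfg : g (y * ζ ^ (-w)) = y * ζ ^ (-w) := by
    rw [map_mul, hu, map_zpow₀, hg, mul_assoc, ← zpow_mul, ← zpow_add₀ hζ0]
    congr 1
    rw [show u + a * -w = (u - (a - 1) * w) + -w by ring, zpow_add₀ hζ0,
      (hζ.zpow_eq_one_iff_dvd _).mpr (by exact_mod_cast hw), one_mul]
  refine descend hζ x y hy (-w) fun σ => ?_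
  obtain ⟨s, hs⟩ := hc σ
  obtain ⟨t, ht⟩ := hz σ
  have hv : σ (y * ζ ^ (-w)) = (y * ζ ^ (-w)) * ζ ^ (s + t * -w + w) := by
    rw [map_mul, hs, map_zpow₀, ht, ← zpow_mul, mul_assoc, mul_assoc, ← zpow_add₀ hζ0,
      ← zpow_add₀ hζ0]
    congr 2; ring
  generalize s + t * -w + w = v at hv
  have h1 := hcomm g σ (y * ζ ^ (-w))
  have hne : y * ζ ^ (-w) ≠ 0 := mul_ne_zero hy0 (zpow_ne_zero _ hζ0)
  generalize y * ζ ^ (-w) = y' at *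
  rw [hfg, hv, map_mul, hfg, map_zpow₀, hg] at h1
  have h2 := mul_left_cancel₀ hne h1
  have h3 : ζ ^ ((a - 1) * v) = 1 := by
    rw [sub_mul, one_mul, zpow_sub₀ hζ0, zpow_mul, h2, div_self (zpow_ne_zero _ hζ0)]
  rw [hζ.zpow_eq_one_iff_dvd] at h3
  have hpZ : Prime (p : ℤ) := Nat.prime_iff_prime_int.mp hp
  have hca : IsCoprime ((p : ℤ) ^ n) (a - 1) :=
    IsCoprime.pow_left ((Prime.coprime_iff_not_dvd hpZ).mpr ha)
  push_cast at h3
  rw [hv, (hζ.zpow_eq_one_iff_dvd _).mpr (by exact_mod_cast hca.dvd_of_dvd_mul_left h3), mul_one]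

theorem stepA {k K : Type*} [Field k] [Field K] [Algebra k K] [FiniteDimensional k K]
    [IsGalois k K] {p n : ℕ} (hp : p.Prime)
    {ζ : K} (hζ : IsPrimitiveRoot ζ (p ^ n)) (x : k) (y : K) (hy0 : y ≠ 0)
    (hy : y ^ p ^ n = algebraMap k K x) (hN : ∀ ν : K ≃ₐ[k] K, ν ζ = ζ → ν y = y)
    (g : K ≃ₐ[k] K) (hgen : ∀ σ : K ≃ₐ[k] K, ∃ i : ℕ, σ ζ = (g ^ i) ζ)
    (a : ℤ) (hg : g ζ = ζ ^ a) (ha : (p : ℤ) ∣ a - 1)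
    (hsp : p = 2 → 2 ≤ n → ∀ σ : K ≃ₐ[k] K, σ ζ ≠ ζ⁻¹) :
    ∃ z : k, z ^ p ^ n = x := by
  have hP : p ^ n ≠ 0 := pow_ne_zero _ hp.ne_zero
  have hζ0 : ζ ≠ 0 := hζ.ne_zero hP
  have hgi : ∀ i : ℕ, (g ^ i) ζ = ζ ^ (a ^ i) := by
    intro i
    induction i with
    | zero => simp
    | succ i ih => rw [pow_succ', AlgEquiv.mul_apply, ih, map_zpow₀, hg, ← zpow_mul, pow_succ']
  obtain ⟨m, hm, hmu⟩ := nt_key p hp n a ha (by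
    intro h2 hn j hj
    apply hsp h2 hn (g ^ j)
    rw [hgi]
    have : ζ ^ (a ^ j + 1) = 1 := (hζ.zpow_eq_one_iff_dvd _).mpr (by exact_mod_cast hj)
    rw [zpow_add₀ hζ0, zpow_one] at this
    exact eq_inv_of_mul_eq_one_left this)
  have hc : ∃ u : ℤ, g y = y * ζ ^ u := by
    have : (g y / y) ^ p ^ n = 1 := by
      rw [div_pow, ← map_pow, hy, g.commutes, ← hy, div_self (pow_ne_zero _ hy0)]
    obtain ⟨u, hu⟩ := exists_zpow hP hζ this
    exact ⟨u, by rw [← hu]; field_simp⟩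
  obtain ⟨u, hu⟩ := hc
  have hgy : ∀ i : ℕ, (g ^ i) y = y * ζ ^ ((∑ j ∈ Finset.range i, a ^ j) * u) := by
    intro i
    induction i with
    | zero => simp
    | succ i ih =>
      rw [pow_succ, AlgEquiv.mul_apply, hu, map_mul, ih, map_zpow₀, hgi, ← zpow_mul, mul_assoc,
        ← zpow_add₀ hζ0, Finset.sum_range_succ]
      congr 2; ring
  have hgm : (g ^ m) y = y := by
    apply hN
    rw [hgi]
    have : ζ ^ (a ^ m - 1) = 1 := (hζ.zpow_eq_one_iff_dvd _).mpr (by exact_mod_cast hm)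
    rw [zpow_sub₀ hζ0, zpow_one, div_eq_one_iff_eq hζ0] at this
    exact this
  rw [hgy] at hgm
  have h1 := mul_left_cancel₀ hy0 (hgm.trans (mul_one y).symm)
  rw [hζ.zpow_eq_one_iff_dvd] at h1
  obtain ⟨w, hw⟩ := hmu u (by exact_mod_cast h1)
  have hfg : g (y * ζ ^ (-w)) = y * ζ ^ (-w) := by
    rw [map_mul, hu, map_zpow₀, hg, mul_assoc, ← zpow_mul, ← zpow_add₀ hζ0]
    congr 1
    rw [show u + a * -w = (u - (a - 1) * w) + -w by ring, zpow_add₀ hζ0,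
      (hζ.zpow_eq_one_iff_dvd _).mpr (by exact_mod_cast hw), one_mul]
  have hfgi : ∀ i : ℕ, (g ^ i) (y * ζ ^ (-w)) = y * ζ ^ (-w) := by
    intro i
    induction i with
    | zero => simp
    | succ i ih => rw [pow_succ, AlgEquiv.mul_apply, hfg, ih]
  refine descend hζ x y hy (-w) fun σ => ?_
  obtain ⟨i, hi⟩ := hgen σ
  have hν : ((g ^ i)⁻¹ * σ) ζ = ζ := by
    rw [AlgEquiv.mul_apply, hi, ← AlgEquiv.mul_apply, inv_mul_cancel, AlgEquiv.one_apply]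
  have hνy : ((g ^ i)⁻¹ * σ) (y * ζ ^ (-w)) = y * ζ ^ (-w) := by
    rw [map_mul, hN _ hν, map_zpow₀, hν]
  calc σ (y * ζ ^ (-w)) = (g ^ i) (((g ^ i)⁻¹ * σ) (y * ζ ^ (-w))) := by
        rw [← AlgEquiv.mul_apply, mul_inv_cancel_left]
    _ = _ := by rw [hνy, hfgi]

theorem exists_gen {k K : Type*} [Field k] [Field K] [Algebra k K] {p n : ℕ} (hp : p.Prime)
    {ζ : K} (hζ : IsPrimitiveRoot ζ (p ^ n)) [Finite (K ≃ₐ[k] K)]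
    (hsp : p = 2 → 2 ≤ n → ∀ σ : K ≃ₐ[k] K, σ ζ ≠ ζ⁻¹) :
    ∃ g : K ≃ₐ[k] K, ∀ σ : K ≃ₐ[k] K, ∃ i : ℕ, σ ζ = (g ^ i) ζ := by
  have hP : p ^ n ≠ 0 := pow_ne_zero _ hp.ne_zero
  have := NeZero.mk hP
  have hζ0 : ζ ≠ 0 := hζ.ne_zero hP
  let χ := hζ.autToPow k
  have hcyc : IsCyclic χ.range := by
    by_cases h2 : p = 2
    · subst h2
      apply cyclic_two
      rintro hn ⟨σ, hσ⟩
      apply hsp rfl hn σ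
      have h1 := hζ.autToPow_spec k σ
      change ζ ^ ((χ σ : (ZMod (2 ^ n))ˣ) : ZMod (2 ^ n)).val = σ ζ at h1
      rw [hσ] at h1
      rw [← h1]
      apply eq_inv_of_mul_eq_one_left
      rw [← pow_succ, hζ.pow_eq_one_iff_dvd, ← ZMod.natCast_eq_zero_iff]
      simp
    · have := ZMod.isCyclic_units_of_prime_pow p hp h2 n
      infer_instance
  obtain ⟨⟨_, g, rfl⟩, hg⟩ := hcyc.exists_generator
  refine ⟨g, fun σ => ?_⟩
  have h1 := hg ⟨χ σ, σ, rfl⟩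
  rw [← mem_powers_iff_mem_zpowers] at h1
  obtain ⟨i, hi⟩ := h1
  refine ⟨i, ?_⟩
  have h2 : χ (g ^ i) = χ σ := by
    rw [map_pow]
    simpa using congrArg Subtype.val hi
  rw [← hζ.autToPow_spec k σ, ← hζ.autToPow_spec k (g ^ i)]
  change ζ ^ ((χ σ : (ZMod (p ^ n))ˣ) : ZMod (p ^ n)).val =
    ζ ^ ((χ (g ^ i) : (ZMod (p ^ n))ˣ) : ZMod (p ^ n)).val
  rw [h2]

theorem hilbert90 {k L : Type*} [Field k] [Field L] [Algebra k L] (γ : L ≃ₐ[k] L)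
    (hr : 0 < orderOf γ) (ω : L) (hω : ∏ i ∈ Finset.range (orderOf γ), (γ ^ i) ω = 1) :
    ∃ β : L, β ≠ 0 ∧ ω * γ β = β := by
  set r := orderOf γ with hrdef
  let c : ℕ → L := fun i => ∏ j ∈ Finset.range i, (γ ^ j) ω
  have hcs : ∀ i, ω * γ (c i) = c (i + 1) := by
    intro i
    simp only [c]
    rw [Finset.prod_range_succ', map_prod, mul_comm]
    congr 1
    refine Finset.prod_congr rfl fun j _ => ?_
    rw [pow_succ', AlgEquiv.mul_apply]
  have hli : LinearIndependent L (fun i : Fin r => ((γ ^ (i : ℕ) : L ≃ₐ[k] L) : L → L)) :=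
    LinearIndependent.comp (ι' := Fin r)
      (linearIndependent_monoidHom L L) (fun i => ((γ ^ (i : ℕ) : L ≃ₐ[k] L) : L →* L))
      (fun i j h => by
        have h' : γ ^ (i : ℕ) = γ ^ (j : ℕ) := by
          ext z; exact DFunLike.ext_iff.1 h z
        exact Fin.ext (pow_injOn_Iio_orderOf (by simp [← hrdef]) (by simp [← hrdef]) h'))
  have hex : ∃ z : L, ∑ i ∈ Finset.range r, c i * (γ ^ i) z ≠ 0 := by
    by_contra! hcon
    have h := Fintype.linearIndependent_iff.1 hli (fun i => c i) (by
      funext z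
      have := hcon z
      rw [← Fin.sum_univ_eq_sum_range (fun i => c i * (γ ^ i) z) r] at this
      simpa using this) ⟨0, hr⟩
    simp [c] at h
  obtain ⟨z, hz⟩ := hex
  refine ⟨_, hz, ?_⟩
  have h1 : ω * γ (∑ i ∈ Finset.range r, c i * (γ ^ i) z) =
      ∑ i ∈ Finset.range r, c (i + 1) * (γ ^ (i + 1)) z := by
    rw [map_sum, Finset.mul_sum]
    refine Finset.sum_congr rfl fun i _ => ?_
    rw [map_mul, ← mul_assoc, hcs, pow_succ', AlgEquiv.mul_apply]
  have h2 := Finset.sum_range_succ (fun i => c i * (γ ^ i) z) r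
  have h3 := Finset.sum_range_succ' (fun i => c i * (γ ^ i) z) r
  have h4 : c r = c 0 := by simp only [c]; rw [hω]; simp
  have h5 : γ ^ r = γ ^ 0 := by rw [hrdef, pow_orderOf_eq_one, pow_zero]
  rw [h4, h5] at h2
  rw [h1]
  exact add_right_cancel (h3.symm.trans h2)

theorem stepB {k E : Type*} [Field k] [Field E] [Algebra k E] [FiniteDimensional k E]
    [IsGalois k E] {p n : ℕ} (hp : p.Prime) (hn : n ≠ 0)
    (hμ : ∃ ξ : k, ξ ^ p = 1 ∧ ξ ≠ 1)
    (γ : E ≃ₐ[k] E) (hγ : ∀ σ : E ≃ₐ[k] E, σ ∈ Subgroup.zpowers γ)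
    (τ : E ≃ₐ[k] E) (hτ : orderOf τ = p) (hτM : ∀ η : E, η ^ p ^ n = 1 → τ η = η) :
    ∃ x : kˣ, (∃ y : E, y ^ p ^ n = algebraMap k E x) ∧ ¬ ∃ z : k, z ^ p ^ n = (x : k) := by
  have hP : p ^ n ≠ 0 := pow_ne_zero _ hp.ne_zero
  have := NeZero.mk hP
  obtain ⟨ξ, hξ, hξ1⟩ := hμ
  let f : rootsOfUnity (p ^ n) E →* rootsOfUnity (p ^ n) E :=
    restrictRootsOfUnity γ (p ^ n) / MonoidHom.id _
  have hf : ∀ η, ((f η : Eˣ) : E) = γ ((η : Eˣ) : E) / ((η : Eˣ) : E) := by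
    intro η
    simp [f]
  have hξP : (algebraMap k E ξ) ^ p ^ n = 1 := by
    obtain ⟨m, rfl⟩ := Nat.exists_eq_succ_of_ne_zero hn
    rw [pow_succ', pow_mul, ← map_pow, hξ, map_one, one_pow]
  have hns : ¬ Function.Surjective f := by
    rw [← Finite.injective_iff_surjective]
    intro hinj
    have h1 : f (rootsOfUnity.mkOfPowEq _ hξP) = 1 := by
      ext
      rw [hf]
      have : algebraMap k E ξ ≠ 0 := by
        rintro h; rw [h, zero_pow hP] at hξP; exact zero_ne_one hξP
      simp [this]
    have h2 := hinj (h1.trans (map_one f).symm)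
    have h3 := congrArg (fun u : rootsOfUnity (p ^ n) E => ((u : Eˣ) : E)) h2
    simp at h3
    exact hξ1 h3
  have hω : ∃ ω, ω ∉ f.range ∧ ω ^ p ∈ f.range := by
    obtain ⟨ω0, hω0⟩ := not_forall.mp hns
    have hex : ∃ j, ω0 ^ p ^ j ∈ f.range := ⟨n, by
      have : ω0 ^ p ^ n = 1 := by
        ext; simpa using (mem_rootsOfUnity' _ _).mp ω0.2
      rw [this]; exact one_mem _⟩
    classical
    obtain ⟨e, he⟩ : ∃ e, Nat.find hex = e + 1 := by
      refine Nat.exists_eq_succ_of_ne_zero fun h0 => hω0 ?_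
      have := Nat.find_spec hex
      rw [h0] at this
      simpa using this
    have h1 := Nat.find_spec hex
    rw [he, pow_succ, pow_mul] at h1
    exact ⟨_, Nat.find_min hex (show e < _ by omega), h1⟩
  obtain ⟨ω, hω1, η, hη⟩ := hω
  -- the norm of `ω` is trivial
  have hdvd : p ∣ orderOf γ := by
    obtain ⟨i, hi⟩ := hγ τ
    rw [← hτ]
    apply orderOf_dvd_of_pow_eq_one
    simp only at hi
    rw [← hi, ← zpow_natCast, ← zpow_mul, mul_comm, zpow_mul, zpow_natCast, pow_orderOf_eq_one,
      one_zpow]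
  have hpos : 0 < orderOf γ := orderOf_pos γ
  obtain ⟨s, hs⟩ := hdvd
  have hγs : ∀ η : E, η ^ p ^ n = 1 → (γ ^ s) η = η := by
    have hmem : γ ^ s ∈ Subgroup.zpowers τ := by
      obtain ⟨i, hi⟩ := mem_powers_iff_mem_zpowers.mpr (hγ τ)
      simp only at hi
      have hsi : s ∣ i := by
        have h1 : γ ^ (i * p) = 1 := by rw [pow_mul, hi, ← hτ, pow_orderOf_eq_one]
        have h2 := orderOf_dvd_of_pow_eq_one h1
        rw [hs, mul_comm] at h2
        exact Nat.dvd_of_mul_dvd_mul_right hp.pos h2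
      obtain ⟨j, rfl⟩ := hsi
      have hle : Subgroup.zpowers τ ≤ Subgroup.zpowers (γ ^ s) := by
        rw [Subgroup.zpowers_le, ← hi, pow_mul]
        exact Subgroup.pow_mem _ (Subgroup.mem_zpowers _) _
      have hs0 : s ≠ 0 := by rintro rfl; rw [mul_zero] at hs; omega
      have hord : orderOf (γ ^ s) = p := by
        rw [orderOf_pow_of_dvd hs0 ⟨p, by rw [hs, mul_comm]⟩, hs, Nat.mul_div_cancel _ (by omega)]
      have heq := Subgroup.eq_of_le_of_card_ge hle (by rw [Nat.card_zpowers, Nat.card_zpowers, hτ, hord])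
      rw [heq]
      exact Subgroup.mem_zpowers _
    intro η hη
    obtain ⟨i, hi⟩ := (mem_powers_iff_mem_zpowers.mpr hmem)
    simp only at hi
    rw [← hi]
    clear hi
    induction i with
    | zero => simp
    | succ i ih => rw [pow_succ, AlgEquiv.mul_apply, hτM η hη, ih]
  have hηP : ((η : Eˣ) : E) ^ p ^ n = 1 := (mem_rootsOfUnity' _ _).mp η.2
  have hωP : ((ω : Eˣ) : E) ^ p ^ n = 1 := (mem_rootsOfUnity' _ _).mp ω.2
  have hηω : ((ω : Eˣ) : E) ^ p = γ ((η : Eˣ) : E) / ((η : Eˣ) : E) := by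
    rw [← hf, hη]; simp
  have hη0 : ((η : Eˣ) : E) ≠ 0 := Units.ne_zero _
  generalize hηE : ((η : Eˣ) : E) = ηE at *
  generalize hωE : ((ω : Eˣ) : E) = ωE at *
  have htel : ∀ i : ℕ, ∏ j ∈ Finset.range i, (γ ^ j) (ωE ^ p) = (γ ^ i) ηE / ηE := by
    intro i
    induction i with
    | zero => simp [hη0]
    | succ i ih =>
      rw [Finset.prod_range_succ, ih, hηω, map_div₀, pow_succ, AlgEquiv.mul_apply]
      have : (γ ^ i) ηE ≠ 0 := (map_ne_zero (γ ^ i)).mpr hη0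
      field_simp
  have hnorm0 : (∏ j ∈ Finset.range s, (γ ^ j) ωE) ^ p = 1 := by
    rw [← Finset.prod_pow]
    simp_rw [← map_pow]
    rw [htel, hγs _ hηP, div_self hη0]
  have hnorm1 : ∀ e : ℕ, ∏ j ∈ Finset.range (s * e), (γ ^ j) ωE =
      (∏ j ∈ Finset.range s, (γ ^ j) ωE) ^ e := by
    have hper : ∀ e : ℕ, (γ ^ (s * e)) ωE = ωE := by
      intro e
      induction e with
      | zero => simp
      | succ e ih => rw [mul_add, mul_one, pow_add, AlgEquiv.mul_apply, hγs _ hωP, ih]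
    intro e
    induction e with
    | zero => simp
    | succ e ih =>
      rw [mul_add, mul_one, Finset.prod_range_add, ih, pow_succ]
      congr 1
      refine Finset.prod_congr rfl fun j _ => ?_
      rw [add_comm, pow_add, AlgEquiv.mul_apply, hper]
  have hnorm : ∏ j ∈ Finset.range (orderOf γ), (γ ^ j) ωE = 1 := by
    rw [hs, mul_comm, hnorm1, hnorm0]
  obtain ⟨β, hβ0, hβ⟩ := hilbert90 γ hpos ωE hnorm
  have hβP : γ (β ^ p ^ n) = β ^ p ^ n := by
    have := congrArg (· ^ p ^ n) hβ
    simp only [mul_pow, hωP, one_mul] at this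
    rw [map_pow, this]
  have hfix : ∀ {b : E}, γ b = b → ∀ σ : E ≃ₐ[k] E, σ b = b := by
    intro b hb σ
    obtain ⟨i, hi⟩ := mem_powers_iff_mem_zpowers.mpr (hγ σ)
    simp only at hi
    rw [← hi]
    clear hi
    induction i with
    | zero => simp
    | succ i ih => rw [pow_succ, AlgEquiv.mul_apply, hb, ih]
  obtain ⟨x, hx⟩ := (IsGalois.mem_range_algebraMap_iff_fixed (F := k) (β ^ p ^ n)).mpr (hfix hβP)
  have hx0 : x ≠ 0 := by
    rintro rfl
    rw [map_zero] at hx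
    exact pow_ne_zero _ hβ0 hx.symm
  refine ⟨Units.mk0 x hx0, ⟨β, hx.symm⟩, ?_⟩
  rintro ⟨z, hz⟩
  simp only [Units.val_mk0] at hz
  have hz0 : z ≠ 0 := by
    rintro rfl
    rw [zero_pow hP] at hz
    exact hx0 hz.symm
  have hz0' : algebraMap k E z ≠ 0 := by simpa using hz0
  have hq : (algebraMap k E z / β) ^ p ^ n = 1 := by
    rw [div_pow, ← map_pow, hz, hx, div_self (pow_ne_zero _ hβ0)]
  apply hω1
  refine ⟨rootsOfUnity.mkOfPowEq _ hq, ?_⟩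
  ext
  rw [hf, hωE]
  simp only [rootsOfUnity.coe_mkOfPowEq, map_div₀, AlgEquiv.commutes]
  have hγβ : γ β ≠ 0 := by simpa using hβ0
  have hX : algebraMap k E z / γ β / (algebraMap k E z / β) = β / γ β := by
    field_simp
  rw [hX, div_eq_iff hγβ, hβ]

/-- An integer `b` with `b ^ p ≡ 1 mod d`, `b ≡ 1 mod p ^ n` and `b ≡ 1 mod q` for all other
primes `q ∣ d` is `1` modulo `d`. -/
theorem tau_trivial {p n d : ℕ} (hp : p.Prime)
    (hnd : ¬ p ^ (n + 1) ∣ d) {b : ℤ} (hb : (p : ℤ) ^ n ∣ b - 1) (hbp : (d : ℤ) ∣ b ^ p - 1)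
    (hq : ∀ q : ℕ, q.Prime → q ∣ d → q ≠ p → (q : ℤ) ∣ b - 1) : (d : ℤ) ∣ b - 1 := by
  rw [Int.natCast_dvd, Nat.dvd_iff_prime_pow_dvd_dvd]
  intro q r hqp hqr
  rw [← Int.natCast_dvd]
  push_cast
  by_cases hqe : q = p
  · subst hqe
    refine (pow_dvd_pow _ ?_).trans hb
    by_contra hlt
    exact hnd ((pow_dvd_pow _ (by omega)).trans hqr)
  · rcases Nat.eq_zero_or_pos r with rfl | hr
    · simp
    have h1 := hq q hqp ((dvd_pow_self q hr.ne').trans hqr) hqe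
    have hqZ : Prime (q : ℤ) := Nat.prime_iff_prime_int.mp hqp
    have h2 : (q : ℤ) ^ r ∣ (∑ i ∈ Finset.range p, b ^ i) * (b - 1) := by
      rw [geom_sum_mul]
      exact (by exact_mod_cast hqr : (q : ℤ) ^ r ∣ (d : ℤ)).trans hbp
    have h3 : (q : ℤ) ∣ (∑ i ∈ Finset.range p, b ^ i) - p := by
      have : (∑ i ∈ Finset.range p, b ^ i) - (p : ℤ) = ∑ i ∈ Finset.range p, (b ^ i - 1) := by
        simp
      rw [this]
      exact Finset.dvd_sum fun i _ => h1.trans (by simpa using sub_dvd_pow_sub_pow b 1 i)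
    have h4 : IsCoprime ((q : ℤ) ^ r) (∑ i ∈ Finset.range p, b ^ i) := by
      apply IsCoprime.pow_left
      rw [Prime.coprime_iff_not_dvd hqZ]
      intro h5
      have h6 : (q : ℤ) ∣ p := by
        have := dvd_sub h5 h3
        simpa using this
      rw [Int.natCast_dvd_natCast, Nat.prime_dvd_prime_iff_eq hqp hp] at h6
      exact hqe h6
    exact h4.dvd_of_dvd_mul_left h2

theorem main_abstract {k K : Type*} [Field k] [Field K] [Algebra k K] {d : ℕ} (hd : d ≠ 0)
    [FiniteDimensional k K] [IsGalois k K] [IsCyclotomicExtension {d} k K]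
    {p n : ℕ} (hp : p.Prime) (hn : n ≠ 0) (hpd : p ^ n ∣ d) (hnd : ¬ p ^ (n + 1) ∣ d)
    {ζ : K} (hζ : IsPrimitiveRoot ζ (p ^ n)) (x : k) (y : K) (hy0 : y ≠ 0)
    (hy : y ^ p ^ n = algebraMap k K x)
    (hsp : p = 2 → 2 ≤ n → ∀ σ : K ≃ₐ[k] K, σ ζ ≠ ζ⁻¹)
    (hq : (∃ ξ : k, ξ ^ p = 1 ∧ ξ ≠ 1) → ∀ q : ℕ, q.Prime → q ∣ d → q ≠ p → ∀ τ : K ≃ₐ[k] K,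
      τ ^ p = 1 → τ ζ = ζ → ∀ η : K, η ^ q = 1 → τ η = η) :
    ∃ z : k, z ^ p ^ n = x := by
  have hP : p ^ n ≠ 0 := pow_ne_zero _ hp.ne_zero
  have hζ0 : ζ ≠ 0 := hζ.ne_zero hP
  have hz : ∀ σ : K ≃ₐ[k] K, ∃ u : ℤ, σ ζ = ζ ^ u := by
    intro σ
    exact exists_zpow hP hζ (by rw [← map_pow, hζ.pow_eq_one, map_one])
  obtain ⟨m, rfl⟩ := Nat.exists_eq_succ_of_ne_zero hn
  have hζ1 : IsPrimitiveRoot (ζ ^ p ^ m) p := hζ.pow (Nat.pos_of_ne_zero hP) (pow_succ p m)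
  have key : ∀ (σ : K ≃ₐ[k] K) (a : ℤ), σ ζ = ζ ^ a →
      (σ (ζ ^ p ^ m) = ζ ^ p ^ m ↔ (p : ℤ) ∣ a - 1) := by
    intro σ a ha
    rw [← hζ1.zpow_eq_one_iff_dvd, zpow_sub₀ (hζ1.ne_zero hp.ne_zero), zpow_one,
      div_eq_one_iff_eq (hζ1.ne_zero hp.ne_zero), map_pow, ha, ← zpow_natCast, ← zpow_natCast,
      ← zpow_mul, ← zpow_mul, mul_comm]
  have hcomm : ∀ σ τ : K ≃ₐ[k] K, ∀ z, σ (τ z) = τ (σ z) := by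
    intro σ τ z
    have := (IsCyclotomicExtension.isMulCommutative {d} k K).is_comm.comm σ τ
    exact DFunLike.congr_fun this z
  by_cases hμ : ∃ ξ : k, ξ ^ p = 1 ∧ ξ ≠ 1
  swap
  · have hex : ∃ g : K ≃ₐ[k] K, g (ζ ^ p ^ m) ≠ ζ ^ p ^ m := by
      by_contra! hcon
      obtain ⟨ξ, hξ⟩ := (IsGalois.mem_range_algebraMap_iff_fixed _).mpr hcon
      refine hμ ⟨ξ, (algebraMap k K).injective ?_, ?_⟩
      · rw [map_pow, hξ, hζ1.pow_eq_one, map_one]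
      · rintro rfl
        rw [map_one] at hξ
        exact hζ1.ne_one hp.one_lt hξ.symm
    obtain ⟨g, hg⟩ := hex
    obtain ⟨a, ha⟩ := hz g
    exact sah hcomm hp hζ x y hy0 hy g a ha (fun h => hg ((key g a ha).mpr h))
  replace hq := hq hμ
  have hfix1 : ∀ σ : K ≃ₐ[k] K, σ (ζ ^ p ^ m) = ζ ^ p ^ m := by
    obtain ⟨ξ, hξ, hξ1⟩ := hμ
    have hξp : IsPrimitiveRoot (algebraMap k K ξ) p := by
      have h1 : orderOf (algebraMap k K ξ) = p := by
        have := Fact.mk hp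
        apply orderOf_eq_prime
        · rw [← map_pow, hξ, map_one]
        · simpa using hξ1
      rw [← h1]; exact IsPrimitiveRoot.orderOf _
    obtain ⟨u, hu⟩ := exists_zpow hp.ne_zero hξp hζ1.pow_eq_one
    intro σ
    rw [hu, map_zpow₀, σ.commutes]
  have hN : ∀ ν : K ≃ₐ[k] K, ν ζ = ζ → ν y = y := by
    intro ν hν
    have hνi : ∀ i : ℕ, (ν ^ i) ζ = ζ := by
      intro i
      induction i with
      | zero => simp
      | succ i ih => rw [pow_succ, AlgEquiv.mul_apply, hν, ih]
    have hcop : ¬ p ∣ orderOf ν := by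
      rintro ⟨s, hs⟩
      have hpos : 0 < orderOf ν := orderOf_pos ν
      have hs0 : 0 < s := by
        rcases Nat.eq_zero_or_pos s with rfl | h
        · rw [mul_zero] at hs; omega
        · exact h
      have hτp : (ν ^ s) ^ p = 1 := by rw [← pow_mul, mul_comm, ← hs, pow_orderOf_eq_one]
      have hτ1 : ν ^ s ≠ 1 := by
        intro h
        have := Nat.le_of_dvd hs0 (orderOf_dvd_of_pow_eq_one h)
        rw [hs] at this
        have := hp.two_le
        nlinarith
      have hτζ := hνi s
      generalize ν ^ s = τ at hτp hτ1 hτζ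
      apply hτ1
      obtain ⟨ρ, hρ⟩ := (IsCyclotomicExtension.exists_isPrimitiveRoot k K (S := {d}) (n := d) rfl hd)
      have hρ0 : ρ ≠ 0 := hρ.ne_zero hd
      obtain ⟨b, hb⟩ := exists_zpow hd hρ (w := τ ρ) (by rw [← map_pow, hρ.pow_eq_one, map_one])
      have hgen : ∀ e : ℕ, e ∣ d → (∀ η : K, η ^ e = 1 → τ η = η) → (e : ℤ) ∣ b - 1 := by
        rintro e ⟨f, rfl⟩ he
        have hρf : IsPrimitiveRoot (ρ ^ f) e := hρ.pow (Nat.pos_of_ne_zero hd) (mul_comm e f)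
        have h0 : ρ ^ f ≠ 0 := pow_ne_zero _ hρ0
        have h1 := he _ hρf.pow_eq_one
        rw [map_pow, hb, ← zpow_natCast, ← zpow_mul, mul_comm, zpow_mul, zpow_natCast] at h1
        rw [← hρf.zpow_eq_one_iff_dvd, zpow_sub₀ h0, zpow_one, h1, div_self h0]
      have hτi : ∀ i : ℕ, (τ ^ i) ρ = ρ ^ (b ^ i) := by
        intro i
        induction i with
        | zero => simp
        | succ i ih => rw [pow_succ', AlgEquiv.mul_apply, ih, map_zpow₀, hb, ← zpow_mul, pow_succ']
      have hdb : (d : ℤ) ∣ b - 1 := by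
        refine tau_trivial hp hnd ?_ ?_ ?_
        · have := hgen _ hpd (fun η hη => by
            obtain ⟨u, rfl⟩ := exists_zpow hP hζ hη
            rw [map_zpow₀, hτζ])
          exact_mod_cast this
        · have h1 := hτi p
          rw [hτp, AlgEquiv.one_apply] at h1
          rw [← hρ.zpow_eq_one_iff_dvd, zpow_sub₀ hρ0, zpow_one, ← h1, div_self hρ0]
        · intro q hqp hqd hqne
          exact hgen q hqd (hq q hqp hqd hqne τ hτp hτζ)
      apply IsCyclotomicExtension.algEquiv_eq_of_apply_eq {d} k K
      rintro _ rfl -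
      refine ⟨ρ, hρ, ?_⟩
      rw [← hρ.zpow_eq_one_iff_dvd, zpow_sub₀ hρ0, zpow_one, div_eq_one_iff_eq hρ0] at hdb
      rw [hb, hdb, AlgEquiv.one_apply]
    have : (ν y / y) ^ p ^ (m + 1) = 1 := by
      rw [div_pow, ← map_pow, hy, ν.commutes, ← hy, div_self (pow_ne_zero _ hy0)]
    obtain ⟨u, hu⟩ := exists_zpow hP hζ this
    rw [div_eq_iff hy0] at hu
    have hyi : ∀ i : ℕ, (ν ^ i) y = ζ ^ (u * i) * y := by
      intro i
      induction i with
      | zero => simp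
      | succ i ih =>
        rw [pow_succ, AlgEquiv.mul_apply, hu, map_mul, map_zpow₀, hνi, ih, ← mul_assoc,
          ← zpow_add₀ hζ0]
        congr 2; push_cast; ring
    have h1 := hyi (orderOf ν)
    rw [pow_orderOf_eq_one, AlgEquiv.one_apply, eq_comm, mul_eq_right₀ hy0,
      hζ.zpow_eq_one_iff_dvd] at h1
    have hpZ : Prime (p : ℤ) := Nat.prime_iff_prime_int.mp hp
    have hco : IsCoprime ((p ^ (m + 1) : ℕ) : ℤ) (orderOf ν : ℤ) := by
      rw [Nat.isCoprime_iff_coprime]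
      exact Nat.Coprime.pow_left _ ((Nat.Prime.coprime_iff_not_dvd hp).mpr hcop)
    rw [hu, (hζ.zpow_eq_one_iff_dvd _).mpr (hco.dvd_of_dvd_mul_right h1), one_mul]
  obtain ⟨g, hg⟩ := exists_gen hp hζ hsp
  obtain ⟨a, ha⟩ := hz g
  exact stepA hp hζ x y hy0 hy hN g hg a ha ((key g a ha).mp (hfix1 g)) hsp

theorem pow_of_prime_pow {k : Type*} [Field k] (x : k) (hx : x ≠ 0) (d : ℕ) (hd : d ≠ 0)
    (h : ∀ p n : ℕ, p.Prime → n ≠ 0 → p ^ n ∣ d → ¬ p ^ (n + 1) ∣ d → ∃ z : k, z ^ p ^ n = x) :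
    ∃ z : k, z ^ d = x := by
  induction d using Nat.recOnPosPrimePosCoprime with
  | zero => exact absurd rfl hd
  | one => exact ⟨x, pow_one x⟩
  | prime_pow p n hp hn =>
    exact h p n hp hn.ne' dvd_rfl (by
      rw [Nat.pow_dvd_pow_iff_le_right hp.one_lt]; omega)
  | coprime a b ha hb hab iha ihb =>
    have hsub : ∀ a b : ℕ, a ≠ 0 → Nat.Coprime a b → (∀ p n : ℕ, p.Prime → n ≠ 0 → p ^ n ∣ a * b →
        ¬ p ^ (n + 1) ∣ a * b → ∃ z : k, z ^ p ^ n = x) → ∀ p n : ℕ, p.Prime → n ≠ 0 →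
        p ^ n ∣ a → ¬ p ^ (n + 1) ∣ a → ∃ z : k, z ^ p ^ n = x := by
      intro a b ha0 hab h p n hp hn h1 h2
      refine h p n hp hn (h1.mul_right b) fun h3 => h2 ?_
      refine Nat.Coprime.dvd_of_dvd_mul_right ?_ h3
      apply Nat.Coprime.pow_left
      exact Nat.Coprime.coprime_dvd_left ((dvd_pow_self p hn).trans h1) hab
    obtain ⟨u, hu⟩ := iha (by omega) (hsub a b (by omega) hab h)
    obtain ⟨v, hv⟩ := ihb (by omega) (hsub b a (by omega) hab.symm (by rwa [mul_comm b a]))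
    obtain ⟨s, t, hst⟩ := Nat.isCoprime_iff_coprime.mpr hab
    have hu0 : u ≠ 0 := by rintro rfl; rw [zero_pow (by omega)] at hu; exact hx hu.symm
    have hv0 : v ≠ 0 := by rintro rfl; rw [zero_pow (by omega)] at hv; exact hx hv.symm
    refine ⟨v ^ s * u ^ t, ?_⟩
    have e1 : (v ^ s) ^ (a * b) = x ^ (s * a) := by
      rw [← hv, ← zpow_natCast, ← zpow_natCast, ← zpow_mul, ← zpow_mul]
      congr 1; push_cast; ring
    have e2 : (u ^ t) ^ (a * b) = x ^ (t * b) := by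
      rw [← hu, ← zpow_natCast, ← zpow_natCast, ← zpow_mul, ← zpow_mul]
      congr 1; push_cast; ring
    rw [mul_pow, e1, e2, ← zpow_add₀ hx, hst, zpow_one]

theorem cycloExt_isCyc (k : Type*) [Field k] [CharZero k] (m : ℕ) (hm : m ≠ 0) :
    IsCyclotomicExtension {m} k (cycloExt k m) := by
  have := IntermediateField.isCyclotomicExtension_adjoin_of_exists_isPrimitiveRoot {m} k
    (AlgebraicClosure k) (by
      rintro _ rfl hn
      have := NeZero.mk hn
      exact HasEnoughRootsOfUnity.exists_primitiveRoot _ _)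
  have hset : {b : AlgebraicClosure k | ∃ n ∈ ({m} : Set ℕ), n ≠ 0 ∧ b ^ n = 1} =
      {b | b ^ m = 1} := by
    ext b; simp [hm]
  rw [hset] at this
  exact this

theorem cycloExt_le (k : Type*) [Field k] {e d : ℕ} (h : e ∣ d) : cycloExt k e ≤ cycloExt k d := by
  apply IntermediateField.adjoin.mono
  rintro z (hz : z ^ e = 1)
  obtain ⟨f, rfl⟩ := h
  change z ^ (e * f) = 1
  rw [pow_mul, hz, one_pow]

theorem mem_cycloExt (k : Type*) [Field k] {e : ℕ} {z : AlgebraicClosure k} (hz : z ^ e = 1) :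
    z ∈ cycloExt k e :=
  IntermediateField.subset_adjoin k _ hz

theorem restrict_gen {k L E : Type*} [Field k] [Field L] [Field E] [Algebra k L] [Algebra k E]
    [Normal k E] (i : E →ₐ[k] L) :
    ∃ φ : (L ≃ₐ[k] L) →* (E ≃ₐ[k] E), ∀ σ z, i (φ σ z) = σ (i z) := by
  let _ : Algebra E L := i.toRingHom.toAlgebra
  have : IsScalarTower k E L := IsScalarTower.of_algebraMap_eq fun x => (i.commutes x).symm
  exact ⟨AlgEquiv.restrictNormalHom E, fun σ z => AlgEquiv.restrictNormal_commutes σ E z⟩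

theorem cycloExt_restrict (k : Type*) [Field k] [CharZero k] {e d : ℕ} (h : e ∣ d) (he : e ≠ 0) :
    ∃ (i : cycloExt k e →ₐ[k] cycloExt k d)
      (φ : (cycloExt k d ≃ₐ[k] cycloExt k d) →* (cycloExt k e ≃ₐ[k] cycloExt k e)),
      (∀ σ z, i (φ σ z) = σ (i z)) ∧ ∀ η : cycloExt k d, η ^ e = 1 → ∃ η', i η' = η := by
  have := cycloExt_isCyc k e he
  have : IsGalois k (cycloExt k e) := IsCyclotomicExtension.isGalois {e} k _
  obtain ⟨φ, hφ⟩ := restrict_gen (IntermediateField.inclusion (cycloExt_le k h))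
  refine ⟨_, φ, hφ, fun η hη => ?_⟩
  have hm : (η : AlgebraicClosure k) ∈ cycloExt k e := by
    apply mem_cycloExt
    rw [← IntermediateField.coe_pow, hη, IntermediateField.coe_one]
  exact ⟨⟨η, hm⟩, Subtype.ext rfl⟩

theorem isCyclic_aut (k L : Type*) [Field k] [Field L] [Algebra k L] {q : ℕ} (hq : q.Prime)
    [IsCyclotomicExtension {q} k L] : IsCyclic (L ≃ₐ[k] L) := by
  obtain ⟨θ, hθ⟩ := IsCyclotomicExtension.exists_isPrimitiveRoot k L
    (S := {q}) (n := q) rfl hq.ne_zero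
  have := NeZero.mk hq.ne_zero
  have := ZMod.isCyclic_units_prime hq
  exact isCyclic_of_injective (hθ.autToPow k) (hθ.autToPow_injective (K := k))

/-- If `H¹(k(μ_d)/k, μ_d) ≠ 0`, i.e. some element of `kˣ` is a `d`-th power in `k(μ_d)` but not
in `k`, then either (a) there are distinct primes `p, q ∣ d` with `pⁿ ∥ d` such that some element
of `kˣ` is a `pⁿ`-th power in `k(μ_q)` but not in `k`, or (b) `2ⁿ ∥ d` for some `n ≥ 2` and
`(k, 2ⁿ)` is the special case. -/
theorem nontrivial_kernel_dichotomy (k : Type*) [Field k] [CharZero k] (d : ℕ) (hd : 1 ≤ d)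
    (hH : ∃ x : kˣ, (∃ y : cycloExt k d, y ^ d = algebraMap k (cycloExt k d) (x : k)) ∧
      ¬∃ z : k, z ^ d = (x : k)) :
    (∃ p q n : ℕ, p.Prime ∧ q.Prime ∧ p ≠ q ∧ p ∣ d ∧ q ∣ d ∧
      p ^ n ∣ d ∧ ¬p ^ (n + 1) ∣ d ∧
      ∃ x : kˣ, (∃ y : cycloExt k q, y ^ p ^ n = algebraMap k (cycloExt k q) (x : k)) ∧
        ¬∃ z : k, z ^ p ^ n = (x : k)) ∨
    (∃ n : ℕ, 2 ≤ n ∧ 2 ^ n ∣ d ∧ ¬2 ^ (n + 1) ∣ d ∧ IsSpecialCase k 2 n) := by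
  by_contra hcon
  obtain ⟨hA, hB⟩ := not_or.mp hcon
  obtain ⟨x, ⟨y, hy⟩, hx⟩ := hH
  have hd0 : d ≠ 0 := by omega
  apply hx
  refine pow_of_prime_pow (x : k) x.ne_zero d hd0 fun p n hp hn hpd hnd => ?_
  have := cycloExt_isCyc k d hd0
  have : IsGalois k (cycloExt k d) := IsCyclotomicExtension.isGalois {d} k _
  have : FiniteDimensional k (cycloExt k d) := IsCyclotomicExtension.finiteDimensional {d} k _
  have hP : p ^ n ≠ 0 := pow_ne_zero _ hp.ne_zero
  have hpd1 : p ∣ d := (dvd_pow_self p hn).trans hpd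
  have hy0 : y ≠ 0 := by
    rintro rfl
    rw [zero_pow hd0, eq_comm, map_eq_zero] at hy
    exact x.ne_zero hy
  obtain ⟨ρ, hρ⟩ := IsCyclotomicExtension.exists_isPrimitiveRoot k (cycloExt k d)
    (S := {d}) (n := d) rfl hd0
  obtain ⟨f, hf⟩ := hpd
  have hpd : p ^ n ∣ d := ⟨f, hf⟩
  have hζ : IsPrimitiveRoot (ρ ^ f) (p ^ n) := hρ.pow (Nat.pos_of_ne_zero hd0) (by rw [hf, mul_comm])
  generalize ρ ^ f = ζ at hζ
  refine main_abstract hd0 hp hn hpd hnd hζ (x : k) (y ^ f) (pow_ne_zero _ hy0)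
    (by rw [← pow_mul, mul_comm, ← hf, hy]) ?_ ?_
  · rintro rfl hn2 σ hσ
    apply hB
    refine ⟨n, hn2, hpd, hnd, rfl, hn2, ?_⟩
    obtain ⟨i, φ, hφ, -⟩ := cycloExt_restrict k hpd hP
    refine ⟨φ σ, fun η hη => ?_⟩
    have hi : Function.Injective i := i.toRingHom.injective
    apply hi
    rw [hφ, map_inv₀]
    have h1 : (i η) ^ 2 ^ n = 1 := by
      rw [← map_pow, hη, map_one]
    obtain ⟨u, hu⟩ := exists_zpow hP hζ h1
    rw [hu, map_zpow₀, hσ, inv_zpow]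
  · intro hμ q hq hqd hqp τ hτ hτζ
    have := cycloExt_isCyc k q hq.ne_zero
    have : IsGalois k (cycloExt k q) := IsCyclotomicExtension.isGalois {q} k _
    have : FiniteDimensional k (cycloExt k q) := IsCyclotomicExtension.finiteDimensional {q} k _
    obtain ⟨i, φ, hφ, hsurj⟩ := cycloExt_restrict k hqd hq.ne_zero
    have hφ1 : φ τ = 1 := by
      by_contra hne
      apply hA
      refine ⟨p, q, n, hp, hq, hqp.symm, hpd1, hqd, hpd, hnd, ?_⟩
      have hcyc : IsCyclic (cycloExt k q ≃ₐ[k] cycloExt k q) := isCyclic_aut k _ hq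
      obtain ⟨γ, hγ⟩ := hcyc.exists_generator
      have hord : orderOf (φ τ) = p := by
        have := Fact.mk hp
        exact orderOf_eq_prime (by rw [← map_pow, hτ, map_one]) hne
      refine stepB hp hn hμ γ hγ (φ τ) hord fun η hη => ?_
      have hi : Function.Injective i := i.toRingHom.injective
      apply hi
      rw [hφ]
      have h1 : (i η) ^ p ^ n = 1 := by
        rw [← map_pow, hη, map_one]
      obtain ⟨u, hu⟩ := exists_zpow hP hζ h1
      rw [hu, map_zpow₀, hτζ]
    intro η hη
    obtain ⟨η', rfl⟩ := hsurj η hη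
    rw [← hφ, hφ1, AlgEquiv.one_apply]
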